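/- Let E be a real Hilbert space and K ⊆ E a nonempty closed convex set, with metric projection proj_K : E → K. Then the function f : E → ℝ defined by f(y) = dist(y, K)² is Fréchet differentiable at every y ∈ E, with Fréchet derivative f'(y) given by f'(y)(v) = 2⟨y − proj_K(y), v⟩ for all v ∈ E. -/

import Mathlib

open MeasureTheory Set
open scoped RealInnerProductSpace

noncomputable section

/-- A nearest point of `K` realises the distance to `K`. -/
lemma infDist_eq_norm_sub_of_forall_le {E : Type*} [NormedAddCommGroup E] {K : Set E} {y p : E}
    (hp : p ∈ K) (hmin : ∀ z ∈ K, ‖y - p‖ ≤ ‖y - z‖) : Metric.infDist y K = ‖y - p‖ := by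
  apply le_antisymm
  · rw [← dist_eq_norm]
    exact Metric.infDist_le_dist_of_mem hp
  · refine (Metric.le_infDist ⟨p, hp⟩).2 fun z hz => ?_
    rw [dist_eq_norm]
    exact hmin z hz

/-- The variational inequality for a nearest point of a convex set. -/
lemma real_inner_sub_le_zero_of_forall_le {E : Type*} [NormedAddCommGroup E]
    [InnerProductSpace ℝ E] {K : Set E} (hK : Convex ℝ K) {y p : E}
    (hp : p ∈ K) (hmin : ∀ z ∈ K, ‖y - p‖ ≤ ‖y - z‖) {q : E} (hq : q ∈ K) :
    ⟪y - p, q - p⟫ ≤ 0 := by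
  refine (norm_eq_iInf_iff_real_inner_le_zero hK hp).1 ?_ q hq
  have : Nonempty K := ⟨⟨p, hp⟩⟩
  refine le_antisymm (le_ciInf fun z => hmin z z.2) ?_
  exact ciInf_le (f := fun z : K => ‖y - z‖) ⟨0, by rintro _ ⟨z, rfl⟩; positivity⟩ ⟨p, hp⟩

/-- in a real Hilbert space `E`, for a nonempty closed convex set `K`
with metric projection `proj`, the squared distance `y ↦ dist(y,K)²` is Fréchet
differentiable at every `y`, with derivative `v ↦ 2⟨y − proj y, v⟩`. -/
theorem sq_dist_to_convex_hasFDerivAt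
    {E : Type*} [NormedAddCommGroup E] [InnerProductSpace ℝ E] [CompleteSpace E]
    (K : Set E) (hK_ne : K.Nonempty) (hK_closed : IsClosed K) (hK_conv : Convex ℝ K)
    (proj : E → E)
    (hproj : ∀ y : E, proj y ∈ K ∧ ∀ z ∈ K, ‖y - proj y‖ ≤ ‖y - z‖) :
    ∀ y : E, HasFDerivAt (fun z => Metric.infDist z K ^ 2)
      ((2 : ℝ) • innerSL ℝ (y - proj y)) y := by
  intro y
  have hO : (fun x => Metric.infDist x K ^ 2 - Metric.infDist y K ^ 2 -
      ((2 : ℝ) • innerSL ℝ (y - proj y)) (x - y)) =O[nhds y] fun x => ‖x - y‖ ^ 2 := by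
    refine Asymptotics.IsBigO.of_bound 1 (Filter.Eventually.of_forall fun x => ?_)
    obtain ⟨hp, hpmin⟩ := hproj y
    obtain ⟨hq, hqmin⟩ := hproj x
    have hupper : ‖x - proj x‖ ^ 2 ≤ ‖x - proj y‖ ^ 2 := by
      gcongr
      exact hqmin _ hp
    have hvar := real_inner_sub_le_zero_of_forall_le hK_conv hp hpmin hq
    have hexp (q : E) : ‖x - q‖ ^ 2 = ‖y - proj y‖ ^ 2 + 2 * ⟪y - proj y, x - y⟫ -
        2 * ⟪y - proj y, q - proj y⟫ + ‖x - y - (q - proj y)‖ ^ 2 := by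
      rw [show x - q = (y - proj y) + (x - y - (q - proj y)) by abel, norm_add_sq_real,
        inner_sub_right]
      ring
    have hexp_y := hexp (proj y)
    rw [sub_self, inner_zero_right, sub_zero] at hexp_y
    have hexp_x := hexp (proj x)
    have hsq := sq_nonneg ‖x - y - (proj x - proj y)‖
    rw [infDist_eq_norm_sub_of_forall_le hp hpmin, infDist_eq_norm_sub_of_forall_le hq hqmin,
      smul_apply, innerSL_apply_apply, smul_eq_mul, Real.norm_eq_abs,
      Real.norm_eq_abs, abs_of_nonneg (sq_nonneg ‖x - y‖), one_mul, abs_le]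
    constructor <;> linarith [sq_nonneg ‖x - y‖]
  exact HasFDerivAt.of_isLittleO
    (hO.trans_isLittleO (Asymptotics.isLittleO_pow_sub_sub y one_lt_two))
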